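/- arXiv:2006.09129 — 9 statements merged into one kernel-verified Lean document; each statement's English description precedes it below -/
import Mathlib

section
/- Suppose the weight function α satisfies 2t(1+t)·α(t) ≤ c for all t ≥ 0 (where c > 0). Then for every finite dataset X ⊆ ℝ^n of size m ≥ 1, every x' ∈ X, every z ∈ ℝ^n, every φ with ‖φ‖ ≤ 1, and every label function f with |f(x)| ≤ 1 for all x, the loss gradients satisfy ‖g(φ, z, X, f) − g(φ, z, X∖{x'}, f)‖ ≤ c/m, where both gradients are normalized by the same m = |X|. -/
open scoped RealInnerProductSpace BigOperators

attribute [local instance] Classical.decEq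

/-- The gradient in `φ` of the weighted local loss
`L(φ, z, X, f) = (1/m) · Σ_{x ∈ X} α(‖x − z‖) · (⟪φ, x − z⟫ − f(x))²`,
with an explicit normalization constant `m`. -/
noncomputable def lossGrad {n : ℕ} (α : ℝ → ℝ) (m : ℕ)
    (φ z : EuclideanSpace ℝ (Fin n)) (X : Finset (EuclideanSpace ℝ (Fin n)))
    (f : EuclideanSpace ℝ (Fin n) → ℝ) : EuclideanSpace ℝ (Fin n) :=
  (2 / (m : ℝ)) • ∑ x ∈ X, (α ‖x - z‖ * (⟪φ, x - z⟫ - f x)) • (x - z)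

/-- weight functions with `2t(1+t)·α(t) ≤ c` give gradient sensitivity `c/m`
with respect to removal of one point from the explanation dataset (both gradients
normalized by the same `m = |X|`). -/
theorem lossGrad_sensitivity {n : ℕ} (hn : 1 ≤ n) (c : ℝ) (hc : 0 < c)
    (α : ℝ → ℝ) (hα0 : ∀ t, 0 ≤ α t)
    (hα : ∀ t, 0 ≤ t → 2 * t * (1 + t) * α t ≤ c)
    (X : Finset (EuclideanSpace ℝ (Fin n))) (hX : 1 ≤ X.card)
    (x' : EuclideanSpace ℝ (Fin n)) (hx' : x' ∈ X)
    (z φ : EuclideanSpace ℝ (Fin n)) (hφ : ‖φ‖ ≤ 1)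
    (f : EuclideanSpace ℝ (Fin n) → ℝ) (hf : ∀ x, |f x| ≤ 1) :
    ‖lossGrad α X.card φ z X f - lossGrad α X.card φ z (X.erase x') f‖ ≤ c / X.card := by
  have hdiff : lossGrad α X.card φ z X f - lossGrad α X.card φ z (X.erase x') f
      = (2 / (X.card : ℝ)) • (α ‖x' - z‖ * (⟪φ, x' - z⟫ - f x')) • (x' - z) := by
    unfold lossGrad
    rw [← smul_sub, ← Finset.add_sum_erase X _ hx', add_sub_cancel_right]
  have hres : |⟪φ, x' - z⟫ - f x'| ≤ 1 + ‖x' - z‖ := by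
    have hinner : |⟪φ, x' - z⟫| ≤ ‖x' - z‖ :=
      (abs_real_inner_le_norm _ _).trans (mul_le_of_le_one_left (norm_nonneg _) hφ)
    linarith [abs_sub ⟪φ, x' - z⟫ (f x'), hf x']
  rw [hdiff, norm_smul, norm_smul, Real.norm_eq_abs, Real.norm_eq_abs, abs_mul,
    abs_of_nonneg (hα0 _), abs_of_nonneg (by positivity : (0 : ℝ) ≤ 2 / X.card)]
  calc 2 / (X.card : ℝ) * (α ‖x' - z‖ * |⟪φ, x' - z⟫ - f x'| * ‖x' - z‖)
      ≤ 2 / (X.card : ℝ) * (α ‖x' - z‖ * (1 + ‖x' - z‖) * ‖x' - z‖) := by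
        gcongr
        exact hα0 _
    _ = 2 * ‖x' - z‖ * (1 + ‖x' - z‖) * α ‖x' - z‖ / X.card := by ring
    _ ≤ c / X.card := by
        gcongr
        exact hα _ (norm_nonneg _)
end

section
/- Let n ≥ 1, c > 0, and let α be a nonnegative weight function. Suppose that for every finite dataset X ⊆ ℝ^n of size m ≥ 1, every x' ∈ X, every z ∈ ℝ^n, every φ with ‖φ‖ ≤ 1, and every label function f with |f(x)| ≤ 1 for all x, one has ‖g(φ, z, X, f) − g(φ, z, X∖{x'}, f)‖ ≤ c/m (both gradients normalized by the same m = |X|). Then 2t(1+t)·α(t) ≤ c for every t > 0. -/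
open scoped RealInnerProductSpace BigOperators

attribute [local instance] Classical.decEq

/-- conversely, if the gradient of the loss has sensitivity `c/m` on all
datasets, points of interest, unit-norm `φ` and bounded label functions, then the weight
function must satisfy `2t(1+t)·α(t) ≤ c` for every `t > 0`. -/
theorem weight_bound_of_lossGrad_sensitivity {n : ℕ} (hn : 1 ≤ n) (c : ℝ) (hc : 0 < c)
    (α : ℝ → ℝ) (hα0 : ∀ t, 0 ≤ α t)
    (hsens : ∀ X : Finset (EuclideanSpace ℝ (Fin n)), 1 ≤ X.card →
      ∀ x' ∈ X, ∀ z φ : EuclideanSpace ℝ (Fin n), ‖φ‖ ≤ 1 →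
        ∀ f : EuclideanSpace ℝ (Fin n) → ℝ, (∀ x, |f x| ≤ 1) →
          ‖lossGrad α X.card φ z X f - lossGrad α X.card φ z (X.erase x') f‖ ≤
            c / X.card) :
    ∀ t : ℝ, 0 < t → 2 * t * (1 + t) * α t ≤ c := by
  intro t ht
  set e : EuclideanSpace ℝ (Fin n) := EuclideanSpace.single ⟨0, hn⟩ 1 with he_def
  have he : ‖e‖ = 1 := by simp [he_def]
  have hte : ‖t • e‖ = t := by rw [norm_smul, he, mul_one, Real.norm_of_nonneg ht.le]
  have hinner : ⟪e, t • e⟫ = t := by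
    rw [real_inner_smul_right, real_inner_self_eq_norm_sq, he]
    ring
  have h := hsens {t • e} (by simp) (t • e) (by simp) 0 e he.le (fun _ => -1) (by simp)
  have hα := hα0 t
  have herase : ({t • e} : Finset (EuclideanSpace ℝ (Fin n))).erase (t • e) = ∅ := by simp
  rw [herase] at h
  simp only [lossGrad, Finset.card_singleton, Finset.sum_singleton, Finset.sum_empty, sub_zero,
    smul_zero, Nat.cast_one, div_one, hte, hinner, norm_smul] at h
  rw [Real.norm_of_nonneg zero_le_two,
    Real.norm_of_nonneg (mul_nonneg hα (by linarith))] at h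
  linarith
end

section
/- Suppose the weight function α satisfies 2t(1+t)·α(t) ≤ c for all t ≥ 0 (where c > 0). Then for every finite dataset X ⊆ ℝ^n of size m ≥ 1, every z ∈ ℝ^n, every φ with ‖φ‖ ≤ 1, and every label function f with |f(x)| ≤ 1 for all x, the gradient of the weighted local loss is uniformly bounded: ‖g(φ, z, X, f)‖ ≤ c. -/
open scoped RealInnerProductSpace BigOperators

attribute [local instance] Classical.decEq

/-- weight functions with `2t(1+t)·α(t) ≤ c` give a uniformly bounded loss
gradient: `‖g(φ, z, X, f)‖ ≤ c` whenever `‖φ‖ ≤ 1` and `|f| ≤ 1`. -/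
theorem lossGrad_norm_le {n : ℕ} (hn : 1 ≤ n) (c : ℝ) (hc : 0 < c)
    (α : ℝ → ℝ) (hα0 : ∀ t, 0 ≤ α t)
    (hα : ∀ t, 0 ≤ t → 2 * t * (1 + t) * α t ≤ c)
    (X : Finset (EuclideanSpace ℝ (Fin n))) (hX : 1 ≤ X.card)
    (z φ : EuclideanSpace ℝ (Fin n)) (hφ : ‖φ‖ ≤ 1)
    (f : EuclideanSpace ℝ (Fin n) → ℝ) (hf : ∀ x, |f x| ≤ 1) :
    ‖lossGrad α X.card φ z X f‖ ≤ c := by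
  have hterm : ∀ x ∈ X,
      ‖(α ‖x - z‖ * (⟪φ, x - z⟫ - f x)) • (x - z)‖ ≤ c / 2 := by
    intro x _
    have hinner : |⟪φ, x - z⟫| ≤ ‖x - z‖ :=
      (abs_real_inner_le_norm φ (x - z)).trans
        (mul_le_of_le_one_left (norm_nonneg _) hφ)
    have hres : |⟪φ, x - z⟫ - f x| ≤ 1 + ‖x - z‖ := by
      linarith [abs_sub ⟪φ, x - z⟫ (f x), hf x]
    rw [norm_smul, Real.norm_eq_abs, abs_mul, abs_of_nonneg (hα0 _)]
    calc α ‖x - z‖ * |⟪φ, x - z⟫ - f x| * ‖x - z‖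
        ≤ α ‖x - z‖ * (1 + ‖x - z‖) * ‖x - z‖ := by
          have := hα0 ‖x - z‖
          gcongr
      _ ≤ c / 2 := by linarith [hα ‖x - z‖ (norm_nonneg _)]
  have hm : (0 : ℝ) < X.card := by exact_mod_cast hX
  have hsum := norm_sum_le_of_le X hterm
  rw [Finset.sum_const, nsmul_eq_mul] at hsum
  rw [lossGrad, norm_smul, Real.norm_of_nonneg (by positivity)]
  calc 2 / (X.card : ℝ) * ‖∑ x ∈ X, (α ‖x - z‖ * (⟪φ, x - z⟫ - f x)) • (x - z)‖
      ≤ 2 / (X.card : ℝ) * (X.card * (c / 2)) := by gcongr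
    _ = c := by field_simp
end

section
/- Suppose the weight function α satisfies 2t(1+t)·α(t) ≤ c for all t ≥ 0 (where c > 0). Then the gradient of the weighted local loss is c-Lipschitz in φ: for every finite dataset X of size m ≥ 1, every z ∈ ℝ^n, every label function f, and all φ₁, φ₂ ∈ ℝ^n, ‖g(φ₁, z, X, f) − g(φ₂, z, X, f)‖ ≤ c·‖φ₁ − φ₂‖. (Equivalently, the Hessian of the loss is positive semidefinite with operator norm at most c.) -/
open scoped RealInnerProductSpace BigOperators

/-- for weight functions with `2t(1+t)·α(t) ≤ c`, the gradient of the
weighted local loss is `c`-Lipschitz in `φ`. -/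
theorem lossGrad_lipschitz {n : ℕ} (hn : 1 ≤ n) (c : ℝ) (hc : 0 < c)
    (α : ℝ → ℝ) (hα0 : ∀ t, 0 ≤ α t)
    (hα : ∀ t, 0 ≤ t → 2 * t * (1 + t) * α t ≤ c)
    (X : Finset (EuclideanSpace ℝ (Fin n))) (hX : 1 ≤ X.card)
    (z : EuclideanSpace ℝ (Fin n))
    (f : EuclideanSpace ℝ (Fin n) → ℝ)
    (φ₁ φ₂ : EuclideanSpace ℝ (Fin n)) :
    ‖lossGrad α X.card φ₁ z X f - lossGrad α X.card φ₂ z X f‖ ≤ c * ‖φ₁ - φ₂‖ := by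
  have hm : (0 : ℝ) < X.card := by exact_mod_cast hX
  have hdiff : lossGrad α X.card φ₁ z X f - lossGrad α X.card φ₂ z X f =
      (2 / (X.card : ℝ)) • ∑ x ∈ X, (α ‖x - z‖ * ⟪φ₁ - φ₂, x - z⟫) • (x - z) := by
    rw [lossGrad, lossGrad, ← smul_sub, ← Finset.sum_sub_distrib]
    congr 1
    refine Finset.sum_congr rfl fun x _ => ?_
    rw [← sub_smul, inner_sub_left]
    congr 1
    ring
  have hterm : ∀ x ∈ X, ‖(α ‖x - z‖ * ⟪φ₁ - φ₂, x - z⟫) • (x - z)‖ ≤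
      c / 2 * ‖φ₁ - φ₂‖ := by
    intro x _
    have hweight : α ‖x - z‖ * ‖x - z‖ ^ 2 ≤ c / 2 := by
      have hbound := hα ‖x - z‖ (norm_nonneg _)
      have hnonneg := mul_nonneg (norm_nonneg (x - z)) (hα0 ‖x - z‖)
      linarith
    calc ‖(α ‖x - z‖ * ⟪φ₁ - φ₂, x - z⟫) • (x - z)‖
        = α ‖x - z‖ * ‖⟪φ₁ - φ₂, x - z⟫‖ * ‖x - z‖ := by
          rw [norm_smul, norm_mul, Real.norm_of_nonneg (hα0 _)]
      _ ≤ α ‖x - z‖ * (‖φ₁ - φ₂‖ * ‖x - z‖) * ‖x - z‖ := by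
          gcongr
          · exact hα0 _
          · exact norm_inner_le_norm _ _
      _ = α ‖x - z‖ * ‖x - z‖ ^ 2 * ‖φ₁ - φ₂‖ := by ring
      _ ≤ c / 2 * ‖φ₁ - φ₂‖ := by gcongr
  rw [hdiff, norm_smul, Real.norm_of_nonneg (by positivity)]
  calc 2 / (X.card : ℝ) * ‖∑ x ∈ X, (α ‖x - z‖ * ⟪φ₁ - φ₂, x - z⟫) • (x - z)‖
      ≤ 2 / (X.card : ℝ) * (X.card * (c / 2 * ‖φ₁ - φ₂‖)) := by
        gcongr
        simpa [nsmul_eq_mul] using norm_sum_le_of_le X hterm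
    _ = c * ‖φ₁ - φ₂‖ := by field_simp
end

section
/- Let c > 0, r = (√(2c+1) − 1)/2, and let α_c be the stable weight function. For all x, v, z ∈ ℝ^n and all d ≥ 0 with ‖v − z‖ ≤ d, the weights at the two query points satisfy α_c(‖x − v‖) ≤ (1 + max((d² + 2rd)/r², 2(d² + 2rd + d)/c)) · α_c(‖x − z‖). -/
open scoped RealInnerProductSpace BigOperators

/-- `r = (√(2c+1) − 1)/2`, so that `2r(1+r) = c`. -/
noncomputable def stableRadius (c : ℝ) : ℝ := (Real.sqrt (2 * c + 1) - 1) / 2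

/-- The stable weight function `α_c`: equal to `1` for `t ≤ r` and to `c/(2t(1+t))`
for `t > r`, where `r = (√(2c+1) − 1)/2`. -/
noncomputable def stableWeight (c : ℝ) (t : ℝ) : ℝ :=
  if t ≤ stableRadius c then 1 else c / (2 * t * (1 + t))

theorem stableRadius_pos {c : ℝ} (hc : 0 < c) : 0 < stableRadius c := by
  have h : 1 < Real.sqrt (2 * c + 1) := Real.lt_sqrt_of_sq_lt (by linarith)
  unfold stableRadius
  linarith

theorem two_mul_stableRadius_mul_one_add {c : ℝ} (hc : 0 < c) :
    2 * stableRadius c * (1 + stableRadius c) = c := by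
  have h := Real.sq_sqrt (show 0 ≤ 2 * c + 1 by linarith)
  unfold stableRadius
  linarith

theorem stableWeight_eq_div_max {c : ℝ} (hc : 0 < c) (t : ℝ) :
    stableWeight c t = c / (2 * max t (stableRadius c) * (1 + max t (stableRadius c))) := by
  unfold stableWeight
  split_ifs with h
  · rw [max_eq_right h, two_mul_stableRadius_mul_one_add hc, div_self hc.ne']
  · rw [max_eq_left (le_of_not_ge h)]

/-- The second term of the maximum alone bounds the ratio of two weights. -/
theorem stableWeight_le_mul_of_le_add {c : ℝ} (hc : 0 < c) {s t d : ℝ} (hd : 0 ≤ d)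
    (h : t ≤ s + d) :
    stableWeight c s ≤
      (1 + 2 * (d ^ 2 + 2 * stableRadius c * d + d) / c) * stableWeight c t := by
  rw [stableWeight_eq_div_max hc s, stableWeight_eq_div_max hc t]
  have hr := stableRadius_pos hc
  have hcr := two_mul_stableRadius_mul_one_add hc
  set r := stableRadius c
  have hrm : r ≤ max s r := le_max_right _ _
  have hrt : r ≤ max t r := le_max_right _ _
  have htm : max t r ≤ max s r + d :=
    max_le (h.trans (by linarith [le_max_left s r])) (by linarith)
  generalize max s r = m at *
  generalize max t r = u at *
  have hfactor : 1 + 2 * (d ^ 2 + 2 * r * d + d) / c = 2 * (r + d) * (1 + r + d) / c := by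
    field_simp
    linarith
  have hmul : (u * r) * ((1 + u) * (1 + r)) ≤ ((r + d) * m) * ((1 + r + d) * (1 + m)) := by
    have := mul_nonneg hd (sub_nonneg.2 hrm)
    have := mul_le_mul_of_nonneg_right htm hr.le
    have := mul_nonneg (show 0 ≤ u by linarith) hr.le
    apply mul_le_mul
    · linarith
    · linarith
    · nlinarith
    · nlinarith
  have hm : 0 < m := by linarith
  have hu : 0 < u := by linarith
  rw [hfactor, div_mul_div_comm, div_le_div_iff₀ (by positivity) (by positivity)]
  calc c * (c * (2 * u * (1 + u)))
      = c * (4 * ((u * r) * ((1 + u) * (1 + r)))) := by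
        linear_combination (-2 * c * u * (1 + u)) * hcr
    _ ≤ c * (4 * (((r + d) * m) * ((1 + r + d) * (1 + m)))) := by gcongr
    _ = 2 * (r + d) * (1 + r + d) * c * (2 * m * (1 + m)) := by ring

/-- stability of the stable weight function. If `‖v − z‖ ≤ d` then the
weights of any point `x` relative to the two query points `v` and `z` satisfy
`α_c(‖x − v‖) ≤ (1 + max((d² + 2rd)/r², 2(d² + 2rd + d)/c)) · α_c(‖x − z‖)`. -/
theorem stableWeight_ratio_le {n : ℕ} (hn : 1 ≤ n) (c : ℝ) (hc : 0 < c)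
    (x v z : EuclideanSpace ℝ (Fin n)) (d : ℝ) (hd : 0 ≤ d) (hvz : ‖v - z‖ ≤ d) :
    stableWeight c ‖x - v‖ ≤
      (1 + max ((d ^ 2 + 2 * stableRadius c * d) / stableRadius c ^ 2)
        (2 * (d ^ 2 + 2 * stableRadius c * d + d) / c)) * stableWeight c ‖x - z‖ := by
  have htri : ‖x - z‖ ≤ ‖x - v‖ + d :=
    (norm_sub_le_norm_sub_add_norm_sub x v z).trans (by gcongr)
  have hweight : 0 ≤ stableWeight c ‖x - z‖ := by
    unfold stableWeight
    split_ifs <;> positivity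
  refine (stableWeight_le_mul_of_le_add hc hd htri).trans ?_
  gcongr
  exact le_max_right _ _
end

section
/- Let c > 0, r = (√(2c+1) − 1)/2, and let α_c be the stable weight function. For all x, v, z ∈ ℝ^n and all d with 0 ≤ d ≤ r, if ‖v − z‖ ≤ d then α_c(‖x − v‖) ≤ (1 + d · max(3/r, 2(3r+1)/c)) · α_c(‖x − z‖); in particular the ratio of the weights of two queries at distance at most d is 1 + O(d). -/
open scoped RealInnerProductSpace BigOperators

/-- One-dimensional form of the ratio bound; only `3 / r` is needed as the slope. -/
theorem stableWeight_le_of_le_add {c a b d M : ℝ} (hc : 0 < c) (hd0 : 0 ≤ d)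
    (hdr : d ≤ stableRadius c) (hab : b ≤ a + d) (hM : 3 / stableRadius c ≤ M) :
    stableWeight c a ≤ (1 + d * M) * stableWeight c b := by
  have hr := stableRadius_pos hc
  rw [stableWeight_eq_div_max hc, stableWeight_eq_div_max hc]
  have hrA : stableRadius c ≤ max a (stableRadius c) := le_max_right _ _
  have hrB : stableRadius c ≤ max b (stableRadius c) := le_max_right _ _
  have hBA : max b (stableRadius c) ≤ max a (stableRadius c) + d :=
    max_le (hab.trans (add_le_add_left (le_max_left _ _) d)) (by linarith)
  generalize max a (stableRadius c) = A at *
  generalize max b (stableRadius c) = B at *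
  have hA : 0 < A := hr.trans_le hrA
  have hB : 0 < B := hr.trans_le hrB
  have hMA : 3 ≤ M * A := by
    rw [div_le_iff₀ hr] at hM
    have hM0 : 0 < M := pos_of_mul_pos_left (by linarith) hr.le
    exact hM.trans (mul_le_mul_of_nonneg_left hrA hM0.le)
  have hslope : 1 + 2 * A + d ≤ M * A * (1 + A) := by nlinarith
  have hBsq : B * (1 + B) ≤ (A + d) * (1 + (A + d)) := by gcongr
  have hkey : B * (1 + B) ≤ (1 + d * M) * (A * (1 + A)) := by
    nlinarith [mul_le_mul_of_nonneg_left hslope hd0]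
  rw [← mul_div_assoc, div_le_div_iff₀ (by positivity) (by positivity)]
  nlinarith [mul_le_mul_of_nonneg_left hkey hc.le]

/-- for `0 ≤ d ≤ r`, the ratio of stable weights of two queries at distance
at most `d` is `1 + O(d)`:
`α_c(‖x − v‖) ≤ (1 + d · max(3/r, 2(3r+1)/c)) · α_c(‖x − z‖)`. -/
theorem stableWeight_ratio_le_linear {n : ℕ} (hn : 1 ≤ n) (c : ℝ) (hc : 0 < c)
    (x v z : EuclideanSpace ℝ (Fin n)) (d : ℝ) (hd0 : 0 ≤ d) (hdr : d ≤ stableRadius c)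
    (hvz : ‖v - z‖ ≤ d) :
    stableWeight c ‖x - v‖ ≤
      (1 + d * max (3 / stableRadius c) (2 * (3 * stableRadius c + 1) / c)) *
        stableWeight c ‖x - z‖ := by
  refine stableWeight_le_of_le_add hc hd0 hdr ?_ (le_max_left _ _)
  have h := norm_sub_le_norm_sub_add_norm_sub x v z
  linarith
end

section
/- Let T be a real number with T ≥ e, let a > 1/2, and let b be a real number with 0 < b ≤ (log T)^(−a) and b·T ≥ 1. Then b^(1/(4a)) · (log(b·T))^(5/4) ≤ log T. -/
/-- the key algebraic estimate behind the iteration-count theorem.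
If `T ≥ e`, `a > 1/2`, `0 < b ≤ (log T)^(−a)` and `b·T ≥ 1`, then
`b^(1/(4a)) · (log(b·T))^(5/4) ≤ log T`. -/
theorem rpow_log_key_estimate (T a b : ℝ)
    (hT : Real.exp 1 ≤ T) (ha : 1 / 2 < a)
    (hb0 : 0 < b) (hb : b ≤ Real.log T ^ (-a)) (hbT : 1 ≤ b * T) :
    b ^ (1 / (4 * a)) * Real.log (b * T) ^ ((5 : ℝ) / 4) ≤ Real.log T := by
  have hT0 : 0 < T := (Real.exp_pos 1).trans_le hT
  have hL : 1 ≤ Real.log T := (Real.le_log_iff_exp_le hT0).2 hT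
  have hL0 : 0 < Real.log T := one_pos.trans_le hL
  have ha0 : 0 < a := by linarith
  have hb1 : b ≤ 1 := hb.trans (Real.rpow_le_one_of_one_le_of_nonpos hL (by linarith))
  have hlog : Real.log (b * T) ≤ Real.log T :=
    Real.log_le_log (by positivity) (mul_le_of_le_one_left hT0.le hb1)
  have hpow : b ^ (1 / (4 * a)) ≤ Real.log T ^ (-(1 / 4) : ℝ) := by
    calc b ^ (1 / (4 * a)) ≤ (Real.log T ^ (-a)) ^ (1 / (4 * a)) :=
          Real.rpow_le_rpow hb0.le hb (by positivity)
      _ = Real.log T ^ (-(1 / 4) : ℝ) := by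
          rw [← Real.rpow_mul hL0.le]
          congr 1
          field_simp
  calc b ^ (1 / (4 * a)) * Real.log (b * T) ^ ((5 : ℝ) / 4)
      ≤ Real.log T ^ (-(1 / 4) : ℝ) * Real.log T ^ ((5 : ℝ) / 4) :=
        mul_le_mul hpow (Real.rpow_le_rpow (Real.log_nonneg hbT) hlog (by norm_num))
          (Real.rpow_nonneg (Real.log_nonneg hbT) _) (Real.rpow_nonneg hL0.le _)
    _ = Real.log T := by
        rw [← Real.rpow_add hL0]
        norm_num
end

section
/- (Faster convergence from a good initialization: the algebraic core of the iteration-count theorem.) Let T be a real number with T ≥ e, let a > 1/2, and let b be a real number with 0 < b ≤ (log T)^(−a). Set T' = b^(1−1/(2a))·T and assume T' ≥ 1. Then (√2·b + √b·(log T')^(1/4)) · (log T') / √T' ≤ (1 + √2) · (log T) / √T. -/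
/-- faster convergence from a good initialization — the algebraic core of
the iteration-count theorem. If `T ≥ e`, `a > 1/2`, `0 < b ≤ (log T)^(−a)` and
`T' = b^(1−1/(2a))·T ≥ 1`, then
`(√2·b + √b·(log T')^(1/4)) · log T' / √T' ≤ (1 + √2) · log T / √T`. -/
theorem faster_convergence_core (T a b : ℝ)
    (hT : Real.exp 1 ≤ T) (ha : 1 / 2 < a)
    (hb0 : 0 < b) (hb : b ≤ Real.log T ^ (-a))
    (T' : ℝ) (hT' : T' = b ^ (1 - 1 / (2 * a)) * T) (hT'1 : 1 ≤ T') :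
    (Real.sqrt 2 * b + Real.sqrt b * Real.log T' ^ ((1 : ℝ) / 4)) * Real.log T' /
        Real.sqrt T' ≤
      (1 + Real.sqrt 2) * Real.log T / Real.sqrt T := by
  have ha0 : 0 < a := by linarith
  have hT0 : 0 < T := (Real.exp_pos 1).trans_le hT
  have hL1 : 1 ≤ Real.log T := (Real.le_log_iff_exp_le hT0).2 hT
  have hL0 : 0 < Real.log T := by linarith
  have hb1 : b ≤ 1 := hb.trans (Real.rpow_le_one_of_one_le_of_nonpos hL1 (by linarith))
  have hinv0 : 0 < 1 / (2 * a) := by positivity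
  have hinv1 : 1 / (2 * a) < 1 := by
    rw [div_lt_one (by positivity)]
    linarith
  have hT'T : T' ≤ T := by
    rw [hT']
    exact mul_le_of_le_one_left hT0.le (Real.rpow_le_one hb0.le hb1 (by linarith))
  have hlog : Real.log T' ≤ Real.log T := Real.log_le_log (by linarith) hT'T
  have hlog0 : 0 ≤ Real.log T' := Real.log_nonneg hT'1
  have hsqrt : Real.sqrt T' = b ^ ((1 - 1 / (2 * a)) / 2) * Real.sqrt T := by
    rw [hT', Real.sqrt_mul (by positivity), Real.sqrt_eq_rpow (b ^ _), ← Real.rpow_mul hb0.le]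
    ring_nf
  have hb_le : b ≤ b ^ ((1 - 1 / (2 * a)) / 2) := by
    simpa using Real.rpow_le_rpow_of_exponent_ge hb0 hb1
      (show (1 - 1 / (2 * a)) / 2 ≤ 1 by linarith)
  have hb_root : b ^ (1 / (4 * a)) ≤ Real.log T ^ (-(1 / 4) : ℝ) := by
    calc b ^ (1 / (4 * a)) ≤ (Real.log T ^ (-a)) ^ (1 / (4 * a)) :=
          Real.rpow_le_rpow hb0.le hb (by positivity)
      _ = Real.log T ^ (-(1 / 4) : ℝ) := by
          rw [← Real.rpow_mul hL0.le]
          congr 1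
          field_simp
  have hsqrt_b : Real.sqrt b = b ^ ((1 - 1 / (2 * a)) / 2) * b ^ (1 / (4 * a)) := by
    rw [← Real.rpow_add hb0, Real.sqrt_eq_rpow]
    congr 1
    field_simp
    ring
  have hnoise : Real.sqrt b * Real.log T' ^ ((1 : ℝ) / 4) ≤ b ^ ((1 - 1 / (2 * a)) / 2) := by
    calc Real.sqrt b * Real.log T' ^ ((1 : ℝ) / 4)
        ≤ b ^ ((1 - 1 / (2 * a)) / 2) * Real.log T ^ (-(1 / 4) : ℝ) *
            Real.log T ^ ((1 : ℝ) / 4) := by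
          rw [hsqrt_b]
          gcongr
      _ = b ^ ((1 - 1 / (2 * a)) / 2) := by
          rw [mul_assoc, ← Real.rpow_add hL0]
          norm_num
  have hpow : 0 < b ^ ((1 - 1 / (2 * a)) / 2) := by positivity
  rw [hsqrt]
  calc (Real.sqrt 2 * b + Real.sqrt b * Real.log T' ^ ((1 : ℝ) / 4)) * Real.log T' /
          (b ^ ((1 - 1 / (2 * a)) / 2) * Real.sqrt T)
      ≤ (Real.sqrt 2 * b ^ ((1 - 1 / (2 * a)) / 2) + b ^ ((1 - 1 / (2 * a)) / 2)) *
          Real.log T / (b ^ ((1 - 1 / (2 * a)) / 2) * Real.sqrt T) := by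
        gcongr
    _ = (1 + Real.sqrt 2) * Real.log T / Real.sqrt T := by
        generalize b ^ ((1 - 1 / (2 * a)) / 2) = p at hpow
        rw [show (Real.sqrt 2 * p + p) * Real.log T =
          p * ((1 + Real.sqrt 2) * Real.log T) by ring, mul_div_mul_left _ _ hpow.ne']
end

section
/- (Gradient sensitivity with respect to the black-box model.) Suppose the weight function α satisfies 2t(1+t)·α(t) ≤ c for all t ≥ 0 (where c > 0). Then for every finite dataset X ⊆ ℝ^n of size m ≥ 1, every z ∈ ℝ^n, all φ₁, φ₂ with ‖φ₁‖ ≤ 1 and ‖φ₂‖ ≤ 1, and all label functions f, f' with |f(x)| ≤ 1 and |f'(x)| ≤ 1 for all x, one has ‖g(φ₁, z, X, f) − g(φ₂, z, X, f')‖ ≤ 2c. -/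
open scoped RealInnerProductSpace BigOperators

attribute [local instance] Classical.decEq

/-- For `‖φ‖ ≤ 1` and labels bounded by `1`, the loss gradient has norm at most `c`. -/
theorem norm_lossGrad_le {n : ℕ} {c : ℝ} {α : ℝ → ℝ} (hα0 : ∀ t, 0 ≤ α t)
    (hα : ∀ t, 0 ≤ t → 2 * t * (1 + t) * α t ≤ c)
    {X : Finset (EuclideanSpace ℝ (Fin n))} (hX : 1 ≤ X.card)
    {φ : EuclideanSpace ℝ (Fin n)} (z : EuclideanSpace ℝ (Fin n)) (hφ : ‖φ‖ ≤ 1)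
    {f : EuclideanSpace ℝ (Fin n) → ℝ} (hf : ∀ x, |f x| ≤ 1) :
    ‖lossGrad α X.card φ z X f‖ ≤ c := by
  have hm : (0 : ℝ) < X.card := by exact_mod_cast hX
  have hterm : ∀ x ∈ X, ‖(α ‖x - z‖ * (⟪φ, x - z⟫ - f x)) • (x - z)‖ ≤ c / 2 := by
    intro x _
    have hres : |⟪φ, x - z⟫ - f x| ≤ 1 + ‖x - z‖ := by
      have hinner : |⟪φ, x - z⟫| ≤ ‖x - z‖ :=
        (abs_real_inner_le_norm φ (x - z)).trans
          (mul_le_of_le_one_left (norm_nonneg _) hφ)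
      linarith [abs_sub (⟪φ, x - z⟫) (f x), hf x]
    rw [norm_smul, Real.norm_eq_abs, abs_mul, abs_of_nonneg (hα0 _)]
    calc α ‖x - z‖ * |⟪φ, x - z⟫ - f x| * ‖x - z‖
        ≤ α ‖x - z‖ * (1 + ‖x - z‖) * ‖x - z‖ := by
          gcongr
          exact hα0 _
      _ ≤ c / 2 := by linarith [hα ‖x - z‖ (norm_nonneg _)]
  have hsum := norm_sum_le_of_le X hterm
  rw [Finset.sum_const, nsmul_eq_mul] at hsum
  rw [lossGrad, norm_smul, Real.norm_of_nonneg (by positivity)]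
  calc 2 / (X.card : ℝ) * ‖∑ x ∈ X, (α ‖x - z‖ * (⟪φ, x - z⟫ - f x)) • (x - z)‖
      ≤ 2 / (X.card : ℝ) * (X.card * (c / 2)) := by gcongr
    _ = c := by field_simp

/-- gradient sensitivity with respect to the black-box model: for weight
functions with `2t(1+t)·α(t) ≤ c`, unit-norm `φ₁, φ₂` and label functions `f, f'`
bounded by `1`, the loss gradients differ by at most `2c`. -/
theorem lossGrad_model_sensitivity {n : ℕ} (hn : 1 ≤ n) (c : ℝ) (hc : 0 < c)
    (α : ℝ → ℝ) (hα0 : ∀ t, 0 ≤ α t)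
    (hα : ∀ t, 0 ≤ t → 2 * t * (1 + t) * α t ≤ c)
    (X : Finset (EuclideanSpace ℝ (Fin n))) (hX : 1 ≤ X.card)
    (z φ₁ φ₂ : EuclideanSpace ℝ (Fin n)) (hφ₁ : ‖φ₁‖ ≤ 1) (hφ₂ : ‖φ₂‖ ≤ 1)
    (f f' : EuclideanSpace ℝ (Fin n) → ℝ) (hf : ∀ x, |f x| ≤ 1) (hf' : ∀ x, |f' x| ≤ 1) :
    ‖lossGrad α X.card φ₁ z X f - lossGrad α X.card φ₂ z X f'‖ ≤ 2 * c := by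
  calc ‖lossGrad α X.card φ₁ z X f - lossGrad α X.card φ₂ z X f'‖
      ≤ ‖lossGrad α X.card φ₁ z X f‖ + ‖lossGrad α X.card φ₂ z X f'‖ := norm_sub_le _ _
    _ ≤ c + c := add_le_add (norm_lossGrad_le hα0 hα hX z hφ₁ hf)
        (norm_lossGrad_le hα0 hα hX z hφ₂ hf')
    _ = 2 * c := (two_mul c).symm
end
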